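/- arXiv:1811.02450 — 6 statements merged into one kernel-verified Lean document; each statement's English description precedes it below -/
import Mathlib

section
/- Let E be a normed space over ℝ or ℂ, n ≥ 1, and let L be a bounded symmetric n-linear form on E. Then sup{|L(x,…,x)| : ‖x‖ ≤ 1} ≤ ‖L‖ ≤ (nⁿ/n!) · sup{|L(x,…,x)| : ‖x‖ ≤ 1}, where ‖L‖ := sup{|L(x₁,…,xₙ)| : ‖x₁‖,…,‖xₙ‖ ≤ 1}. -/
open scoped BigOperators

lemma signs_sum_perm {n : ℕ} (σ : Equiv.Perm (Fin n)) :
    ∑ ε : Fin n → ℤˣ, ((∏ i, ε i) * ∏ i, ε (σ i) : ℤˣ).val = 2 ^ n := by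
  have h : ∀ ε : Fin n → ℤˣ, ((∏ i, ε i) * ∏ i, ε (σ i) : ℤˣ) = 1 := by
    intro ε
    rw [Equiv.prod_comp σ ε, Int.units_mul_self]
  simp only [h]
  simp

lemma signs_sum_other {n : ℕ} (f : Fin n → Fin n) (j : Fin n) (hj : ∀ i, f i ≠ j) :
    ∑ ε : Fin n → ℤˣ, ((∏ i, ε i) * ∏ i, ε (f i) : ℤˣ).val = 0 := by
  have h := Equiv.sum_comp (Equiv.mulRight (Pi.mulSingle j (-1) : Fin n → ℤˣ))
    (fun ε : Fin n → ℤˣ => ((∏ i, ε i) * ∏ i, ε (f i) : ℤˣ).val)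
  have h2 : ∀ ε : Fin n → ℤˣ,
      ((∏ i, (Equiv.mulRight (Pi.mulSingle j (-1) : Fin n → ℤˣ) ε) i) *
        ∏ i, (Equiv.mulRight (Pi.mulSingle j (-1) : Fin n → ℤˣ) ε) (f i) : ℤˣ).val
      = - ((∏ i, ε i) * ∏ i, ε (f i) : ℤˣ).val := by
    intro ε
    have h3 : ∀ i, (Pi.mulSingle j (-1) : Fin n → ℤˣ) (f i) = 1 := fun i =>
      Pi.mulSingle_eq_of_ne (hj i) _
    simp only [Equiv.coe_mulRight, Pi.mul_apply, h3, mul_one, Finset.prod_mul_distrib]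
    rw [Fintype.prod_eq_single (f := (Pi.mulSingle j (-1) : Fin n → ℤˣ)) j (fun i hi => Pi.mulSingle_eq_of_ne hi _)]
    simp
  simp only [h2, Finset.sum_neg_distrib] at h
  linarith

lemma polarization_aux {𝕜 E : Type*} [RCLike 𝕜]
    [NormedAddCommGroup E] [NormedSpace 𝕜 E] {n : ℕ}
    (L : ContinuousMultilinearMap 𝕜 (fun _ : Fin n => E) 𝕜)
    (hL : ∀ (σ : Equiv.Perm (Fin n)) (x : Fin n → E), L (x ∘ σ) = L x) (x : Fin n → E) :
    ∑ ε : Fin n → ℤˣ, (((∏ i, ε i : ℤˣ) : ℤ) : 𝕜) *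
        L (fun _ => ∑ j, (((ε j : ℤˣ) : ℤ) : 𝕜) • x j) =
      2 ^ n * n.factorial * L x := by
  classical
  have h1 : ∀ ε : Fin n → ℤˣ, (((∏ i, ε i : ℤˣ) : ℤ) : 𝕜) *
        L (fun _ => ∑ j, (((ε j : ℤˣ) : ℤ) : 𝕜) • x j) =
      ∑ f : Fin n → Fin n,
        ((((∏ i, ε i) * ∏ i, ε (f i) : ℤˣ).val : ℤ) : 𝕜) * L (x ∘ f) := by
    intro ε
    rw [L.map_sum (fun _ j => (((ε j : ℤˣ) : ℤ) : 𝕜) • x j), Finset.mul_sum]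
    refine Finset.sum_congr rfl fun f _ => ?_
    rw [L.map_smul_univ (fun i => (((ε (f i) : ℤˣ) : ℤ) : 𝕜)) (fun i => x (f i))]
    simp [Function.comp_def, mul_assoc, Units.coe_prod]
  simp only [h1]
  rw [Finset.sum_comm]
  simp only [← Finset.sum_mul, ← Int.cast_sum]
  rw [← Finset.sum_subset (Finset.subset_univ
    (Finset.univ.image (fun σ : Equiv.Perm (Fin n) => (σ : Fin n → Fin n))))]
  · rw [Finset.sum_image (fun a _ b _ h => DFunLike.coe_injective h)]
    simp only [signs_sum_perm, hL]
    simp [Fintype.card_perm]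
    ring
  · intro f _ hf
    have : ¬ Function.Surjective f := by
      intro hs
      apply hf
      rw [Finset.mem_image]
      exact ⟨Equiv.ofBijective f (Finite.surjective_iff_bijective.1 hs), Finset.mem_univ _, rfl⟩
    simp only [Function.Surjective, not_forall, not_exists] at this
    obtain ⟨j, hj⟩ := this
    rw [signs_sum_other f j hj]
    simp

/-- For a bounded symmetric `n`-linear form `L` on a normed space `E` over `𝕜 = ℝ` or `ℂ`,
`sup{|L(x,…,x)| : ‖x‖ ≤ 1} ≤ ‖L‖ ≤ (nⁿ/n!)·sup{|L(x,…,x)| : ‖x‖ ≤ 1}`, where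
`‖L‖ = sup{|L(x₁,…,xₙ)| : all ‖xᵢ‖ ≤ 1}`. -/
theorem sym_multilinear_norm_bounds {𝕜 E : Type*} [RCLike 𝕜]
    [NormedAddCommGroup E] [NormedSpace 𝕜 E] {n : ℕ} (hn : 1 ≤ n)
    (L : ContinuousMultilinearMap 𝕜 (fun _ : Fin n => E) 𝕜)
    (hL : ∀ (σ : Equiv.Perm (Fin n)) (x : Fin n → E), L (x ∘ σ) = L x) :
    sSup {r : ℝ | ∃ x : E, ‖x‖ ≤ 1 ∧ r = ‖L fun _ => x‖} ≤
        sSup {r : ℝ | ∃ x : Fin n → E, (∀ i, ‖x i‖ ≤ 1) ∧ r = ‖L x‖} ∧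
      sSup {r : ℝ | ∃ x : Fin n → E, (∀ i, ‖x i‖ ≤ 1) ∧ r = ‖L x‖} ≤
        ((n : ℝ) ^ n / n.factorial) *
          sSup {r : ℝ | ∃ x : E, ‖x‖ ≤ 1 ∧ r = ‖L fun _ => x‖} := by
  have hb : ∀ x : Fin n → E, (∀ i, ‖x i‖ ≤ 1) → ‖L x‖ ≤ ‖L‖ := by
    intro x hx
    refine (L.le_opNorm x).trans ?_
    exact mul_le_of_le_one_right (norm_nonneg _)
      (Finset.prod_le_one (fun i _ => norm_nonneg _) fun i _ => hx i)
  have bdd1 : BddAbove {r : ℝ | ∃ x : E, ‖x‖ ≤ 1 ∧ r = ‖L fun _ => x‖} := by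
    refine ⟨‖L‖, ?_⟩
    rintro r ⟨x, hx, rfl⟩
    exact hb _ fun _ => hx
  have bdd2 : BddAbove {r : ℝ | ∃ x : Fin n → E, (∀ i, ‖x i‖ ≤ 1) ∧ r = ‖L x‖} := by
    refine ⟨‖L‖, ?_⟩
    rintro r ⟨x, hx, rfl⟩
    exact hb _ hx
  constructor
  · refine csSup_le ⟨_, 0, by simp, rfl⟩ ?_
    rintro r ⟨x, hx, rfl⟩
    exact le_csSup bdd2 ⟨fun _ => x, fun _ => hx, rfl⟩
  · refine csSup_le ⟨_, 0, by simp, rfl⟩ ?_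
    rintro r ⟨x, hx, rfl⟩
    set M := sSup {r : ℝ | ∃ x : E, ‖x‖ ≤ 1 ∧ r = ‖L fun _ => x‖} with hM
    have hn0 : (0 : ℝ) < n := by exact_mod_cast hn
    have hn1 : (n : 𝕜) ≠ 0 := by
      have : n ≠ 0 := by omega
      exact_mod_cast this
    have key : ∀ y : E, ‖y‖ ≤ n → ‖L fun _ => y‖ ≤ (n : ℝ) ^ n * M := by
      intro y hy
      have h1 : ‖((n : 𝕜)⁻¹ • y)‖ ≤ 1 := by
        rw [norm_smul, norm_inv, RCLike.norm_natCast, inv_mul_le_iff₀ hn0]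
        simpa using hy
      have h2 : ‖L fun _ => ((n : 𝕜)⁻¹ • y)‖ ≤ M := le_csSup bdd1 ⟨_, h1, rfl⟩
      have h3 : (L fun _ => y) = (n : 𝕜) ^ n * L fun _ => ((n : 𝕜)⁻¹ • y) := by
        rw [L.map_smul_univ (fun _ => (n : 𝕜)⁻¹) (fun _ => y)]
        simp [hn1]
      rw [h3, norm_mul, norm_pow, RCLike.norm_natCast]
      gcongr
    have sgn : ∀ u : ℤˣ, ‖(((u : ℤˣ) : ℤ) : 𝕜)‖ = 1 := by
      intro u
      rcases Int.units_eq_one_or u with rfl | rfl <;> simp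
    have hpol := congrArg norm (polarization_aux L hL x)
    have hle : ‖∑ ε : Fin n → ℤˣ, (((∏ i, ε i : ℤˣ) : ℤ) : 𝕜) *
        L (fun _ => ∑ j, (((ε j : ℤˣ) : ℤ) : 𝕜) • x j)‖ ≤ 2 ^ n * ((n : ℝ) ^ n * M) := by
      have : ∀ ε ∈ (Finset.univ : Finset (Fin n → ℤˣ)), ‖(((∏ i, ε i : ℤˣ) : ℤ) : 𝕜) *
        L (fun _ => ∑ j, (((ε j : ℤˣ) : ℤ) : 𝕜) • x j)‖ ≤ (n : ℝ) ^ n * M := by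
        intro ε _
        rw [norm_mul, sgn, one_mul]
        apply key
        refine (norm_sum_le_of_le (f := fun j => (((ε j : ℤˣ) : ℤ) : 𝕜) • x j)
          Finset.univ (n := fun _ => 1) fun j _ => ?_).trans ?_
        · rw [norm_smul, sgn, one_mul]
          exact hx j
        · simp
      refine (norm_sum_le_of_le _ this).trans ?_
      simp
    rw [hpol, norm_mul, norm_mul, norm_pow, RCLike.norm_natCast, RCLike.norm_ofNat,
      mul_assoc] at hle
    have h4 := le_of_mul_le_mul_left hle (by positivity)
    have hf : (0 : ℝ) < n.factorial := by exact_mod_cast n.factorial_pos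
    rw [div_mul_eq_mul_div, le_div_iff₀ hf, mul_comm]
    exact h4
end

section
/- For every n ≥ 1 and every m with n ≤ m (including m = ∞), the polarization constant satisfies c_s(n, ℓ₁^m) = nⁿ/n!. Moreover nⁿ/n! is the maximum of c_s(n,E) over all normed spaces E, so ℓ₁ⁿ and ℓ₁ are extremal. -/
open scoped BigOperators

noncomputable section

/-- `sup{|L(x₁,…,xₙ)| : all ‖xᵢ‖ ≤ 1}` for an `n`-linear form `L` on `E`. -/
def mNorm {E : Type*} [NormedAddCommGroup E] [NormedSpace ℝ E] {n : ℕ}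
    (L : ContinuousMultilinearMap ℝ (fun _ : Fin n => E) ℝ) : ℝ :=
  sSup {r : ℝ | ∃ x : Fin n → E, (∀ i, ‖x i‖ ≤ 1) ∧ r = |L x|}

/-- `sup{|L(x,…,x)| : ‖x‖ ≤ 1}` for an `n`-linear form `L` on `E`. -/
def qNorm {E : Type*} [NormedAddCommGroup E] [NormedSpace ℝ E] {n : ℕ}
    (L : ContinuousMultilinearMap ℝ (fun _ : Fin n => E) ℝ) : ℝ :=
  sSup {r : ℝ | ∃ x : E, ‖x‖ ≤ 1 ∧ r = |L fun _ => x|}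

/-- The polarization constant `c_s(n,E)`, the supremum of `‖L‖/‖L̂‖` over bounded symmetric
`n`-linear forms `L` on `E` (with the convention `0/0 = 0`, as in Lean's real division). -/
def polConst (n : ℕ) (E : Type*) [NormedAddCommGroup E] [NormedSpace ℝ E] : ℝ :=
  sSup {r : ℝ | ∃ L : ContinuousMultilinearMap ℝ (fun _ : Fin n => E) ℝ,
    (∀ (σ : Equiv.Perm (Fin n)) (x : Fin n → E), L (x ∘ σ) = L x) ∧
    r = mNorm L / qNorm L}

lemma bdd_m {E : Type*} [NormedAddCommGroup E] [NormedSpace ℝ E] {n : ℕ}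
    (L : ContinuousMultilinearMap ℝ (fun _ : Fin n => E) ℝ) :
    BddAbove {r : ℝ | ∃ x : Fin n → E, (∀ i, ‖x i‖ ≤ 1) ∧ r = |L x|} := by
  refine ⟨‖L‖, ?_⟩
  rintro r ⟨x, hx, rfl⟩
  have h := L.le_opNorm x
  have h2 : ∏ i, ‖x i‖ ≤ 1 := Finset.prod_le_one (fun i _ => norm_nonneg _) (fun i _ => hx i)
  rw [Real.norm_eq_abs] at h
  exact h.trans (mul_le_of_le_one_right (norm_nonneg _) h2)

lemma bdd_q {E : Type*} [NormedAddCommGroup E] [NormedSpace ℝ E] {n : ℕ}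
    (L : ContinuousMultilinearMap ℝ (fun _ : Fin n => E) ℝ) :
    BddAbove {r : ℝ | ∃ x : E, ‖x‖ ≤ 1 ∧ r = |L fun _ => x|} := by
  refine (bdd_m L).mono ?_
  rintro r ⟨x, hx, rfl⟩
  exact ⟨fun _ => x, fun _ => hx, rfl⟩

lemma qNorm_nonneg {E : Type*} [NormedAddCommGroup E] [NormedSpace ℝ E] {n : ℕ}
    (L : ContinuousMultilinearMap ℝ (fun _ : Fin n => E) ℝ) : 0 ≤ qNorm L := by
  apply Real.sSup_nonneg
  rintro r ⟨x, hx, rfl⟩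
  exact abs_nonneg _

lemma le_qNorm {E : Type*} [NormedAddCommGroup E] [NormedSpace ℝ E] {n : ℕ}
    (L : ContinuousMultilinearMap ℝ (fun _ : Fin n => E) ℝ) (y : E) (hy : ‖y‖ ≤ n) (hn : 1 ≤ n) :
    |L fun _ => y| ≤ (n : ℝ) ^ n * qNorm L := by
  have hn0 : (0 : ℝ) < n := by exact_mod_cast hn
  have h1 : |L fun _ => (n : ℝ)⁻¹ • y| ≤ qNorm L := by
    apply le_csSup (bdd_q L)
    refine ⟨_, ?_, rfl⟩
    rw [norm_smul, norm_inv, Real.norm_natCast, inv_mul_le_iff₀ hn0]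
    simpa using hy
  have h2 : (L fun _ => y) = (n : ℝ) ^ n * L fun _ => (n : ℝ)⁻¹ • y := by
    have := L.map_smul_univ (fun _ => (n : ℝ)⁻¹) (fun _ => y)
    rw [this]
    simp only [Finset.prod_const, Finset.card_univ, Fintype.card_fin, smul_eq_mul, inv_pow]
    field_simp
  rw [h2, abs_mul, abs_of_nonneg (by positivity)]
  gcongr

lemma rad_sign_sum {n : ℕ} (f : Fin n → Fin n) :
    ∑ ε ∈ Fintype.piFinset (fun _ : Fin n => ({1, -1} : Finset ℝ)),
      (∏ i, ε i) * ∏ j, ε (f j) = if Function.Bijective f then 2 ^ n else 0 := by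
  have key : ∀ ε : Fin n → ℝ, (∏ i, ε i) * ∏ j, ε (f j)
      = ∏ i, ε i ^ (1 + (Finset.univ.filter (fun j => f j = i)).card) := by
    intro ε
    rw [← Finset.prod_fiberwise' Finset.univ f ε, ← Finset.prod_mul_distrib]
    refine Finset.prod_congr rfl fun i _ => ?_
    rw [Finset.prod_const, pow_add, pow_one]
  simp_rw [key]
  have h2 := Finset.sum_prod_piFinset ({1, -1} : Finset ℝ)
    (fun (i : Fin n) (x : ℝ) => x ^ (1 + (Finset.univ.filter (fun j => f j = i)).card))
  rw [h2]
  have hne : (1 : ℝ) ∉ ({-1} : Finset ℝ) := by norm_num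
  simp only [Finset.sum_insert hne, Finset.sum_singleton, one_pow]
  split_ifs with hf
  · rw [Finset.prod_congr rfl (g := fun _ => (2 : ℝ))]
    · simp
    · intro i _
      obtain ⟨j, hj, hu⟩ := hf.existsUnique i
      have : Finset.univ.filter (fun j => f j = i) = {j} := by
        ext k
        simp only [Finset.mem_filter, Finset.mem_univ, true_and, Finset.mem_singleton]
        exact ⟨fun h => hu k h, fun h => h ▸ hj⟩
      rw [this]
      norm_num
  · have : ¬ Function.Surjective f := fun h => hf (Finite.surjective_iff_bijective.mp h)
    simp only [Function.Surjective, not_forall, not_exists] at this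
    obtain ⟨i, hi⟩ := this
    apply Finset.prod_eq_zero (Finset.mem_univ i)
    rw [Finset.filter_false_of_mem (fun j _ => hi j)]
    norm_num

lemma polarization {E : Type*} [NormedAddCommGroup E] [NormedSpace ℝ E] {n : ℕ}
    (L : ContinuousMultilinearMap ℝ (fun _ : Fin n => E) ℝ)
    (hL : ∀ (σ : Equiv.Perm (Fin n)) (x : Fin n → E), L (x ∘ σ) = L x) (x : Fin n → E) :
    ∑ ε ∈ Fintype.piFinset (fun _ : Fin n => ({1, -1} : Finset ℝ)),
      (∏ i, ε i) * (L fun _ => ∑ i, ε i • x i) = 2 ^ n * n.factorial * L x := by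
  have h1 : ∀ ε : Fin n → ℝ, (∏ i, ε i) * (L fun _ => ∑ i, ε i • x i)
      = ∑ f : Fin n → Fin n, ((∏ i, ε i) * ∏ j, ε (f j)) * L (x ∘ f) := by
    intro ε
    have := L.map_sum (g := fun (_ : Fin n) (i : Fin n) => ε i • x i)
    rw [this, Finset.mul_sum]
    refine Finset.sum_congr rfl fun f _ => ?_
    have := L.map_smul_univ (fun j => ε (f j)) (fun j => x (f j))
    rw [this, smul_eq_mul, mul_assoc]
    rfl
  simp_rw [h1]
  rw [Finset.sum_comm]
  simp_rw [← Finset.sum_mul, rad_sign_sum]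
  have h3 : ∀ f : Fin n → Fin n,
      (if Function.Bijective f then (2 : ℝ) ^ n else 0) * L (x ∘ f)
        = if Function.Bijective f then 2 ^ n * L x else 0 := by
    intro f
    split_ifs with hf
    · rw [← hL (Equiv.ofBijective f hf) x]; rfl
    · simp
  simp_rw [h3]
  rw [← Finset.sum_filter, Finset.sum_const]
  have hc : (Finset.univ.filter (fun f : Fin n → Fin n => Function.Bijective f)).card
      = n.factorial := by
    rw [← Fintype.card_subtype, ← Fintype.card_congr (Equiv.ofBijective
      (fun σ : Equiv.Perm (Fin n) =>
        (⟨σ, σ.bijective⟩ : {f : Fin n → Fin n // Function.Bijective f})) ?_),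
      Fintype.card_perm, Fintype.card_fin]
    constructor
    · intro a b h
      exact Equiv.ext (fun i => congrFun (congrArg Subtype.val h) i)
    · rintro ⟨f, hf⟩
      exact ⟨Equiv.ofBijective f hf, rfl⟩
  rw [hc, nsmul_eq_mul]
  ring

lemma ratio_le {E : Type*} [NormedAddCommGroup E] [NormedSpace ℝ E] {n : ℕ} (hn : 1 ≤ n)
    (L : ContinuousMultilinearMap ℝ (fun _ : Fin n => E) ℝ)
    (hL : ∀ (σ : Equiv.Perm (Fin n)) (x : Fin n → E), L (x ∘ σ) = L x) :
    mNorm L / qNorm L ≤ (n : ℝ) ^ n / n.factorial := by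
  have hf : (0 : ℝ) < n.factorial := by exact_mod_cast n.factorial_pos
  apply div_le_of_le_mul₀ (qNorm_nonneg L) (by positivity)
  apply Real.sSup_le _ (mul_nonneg (by positivity) (qNorm_nonneg L))
  rintro r ⟨x, hx, rfl⟩
  have hp := congrArg abs (polarization L hL x)
  rw [abs_mul, abs_of_nonneg (show (0 : ℝ) ≤ 2 ^ n * n.factorial by positivity)] at hp
  have hb : |∑ ε ∈ Fintype.piFinset (fun _ : Fin n => ({1, -1} : Finset ℝ)),
      (∏ i, ε i) * (L fun _ => ∑ i, ε i • x i)| ≤ 2 ^ n * ((n : ℝ) ^ n * qNorm L) := by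
    refine (Finset.abs_sum_le_sum_abs _ _).trans ?_
    refine (Finset.sum_le_card_nsmul _ _ ((n : ℝ) ^ n * qNorm L) ?_).trans ?_
    · intro ε hε
      have hε1 : ∀ i, |ε i| = 1 := by
        intro i
        have := Fintype.mem_piFinset.mp hε i
        simp only [Finset.mem_insert, Finset.mem_singleton] at this
        rcases this with h | h <;> rw [h] <;> simp
      rw [abs_mul, Finset.abs_prod]
      simp only [hε1, Finset.prod_const_one, one_mul]
      apply le_qNorm L _ _ hn
      refine (norm_sum_le _ _).trans ?_
      refine (Finset.sum_le_card_nsmul _ _ 1 ?_).trans ?_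
      · intro i _
        rw [norm_smul, Real.norm_eq_abs, hε1, one_mul]
        exact hx i
      · simp
    · have hne : (1 : ℝ) ∉ ({-1} : Finset ℝ) := by norm_num
      rw [Fintype.card_piFinset, nsmul_eq_mul]
      simp [Finset.card_insert_of_notMem hne]
  rw [hp] at hb
  have h2 : (0 : ℝ) < 2 ^ n := by positivity
  rw [mul_assoc] at hb
  have hb' := le_of_mul_le_mul_left hb h2
  rw [div_mul_eq_mul_div, le_div_iff₀ hf]
  linarith

lemma polConst_le {E : Type*} [NormedAddCommGroup E] [NormedSpace ℝ E] {n : ℕ} (hn : 1 ≤ n) :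
    polConst n E ≤ (n : ℝ) ^ n / n.factorial := by
  apply Real.sSup_le _ (by positivity)
  rintro r ⟨L, hL, rfl⟩
  exact ratio_le hn L hL

lemma amgm {n : ℕ} (hn : 1 ≤ n) (a : Fin n → ℝ) (ha : ∀ i, 0 ≤ a i) (hs : ∑ i, a i ≤ 1) :
    ∏ i, a i ≤ 1 / (n : ℝ) ^ n := by
  have hn0 : (0 : ℝ) < n := by exact_mod_cast hn
  have h := Real.geom_mean_le_arith_mean_weighted Finset.univ (fun _ : Fin n => (n : ℝ)⁻¹) a
    (fun _ _ => by positivity) (by simp; field_simp) (fun i _ => ha i)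
  have hp : 0 ≤ ∏ i, a i ^ (n : ℝ)⁻¹ :=
    Finset.prod_nonneg fun i _ => Real.rpow_nonneg (ha i) _
  have h2 := pow_le_pow_left₀ hp h n
  rw [← Finset.prod_pow, ← Finset.mul_sum] at h2
  have h3 : ∀ i, (a i ^ (n : ℝ)⁻¹) ^ n = a i := fun i =>
    Real.rpow_inv_natCast_pow (ha i) (by omega)
  simp_rw [h3] at h2
  refine h2.trans ?_
  rw [mul_pow, inv_pow, ← one_div]
  apply mul_le_of_le_one_right (by positivity)
  exact pow_le_one₀ (Finset.sum_nonneg fun i _ => ha i) hs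

lemma le_polConst {E : Type*} [NormedAddCommGroup E] [NormedSpace ℝ E] {n : ℕ} (hn : 1 ≤ n)
    (φ : Fin n → E →L[ℝ] ℝ) (e : Fin n → E) (he : ∀ i, ‖e i‖ ≤ 1)
    (hφe : ∀ i j, φ i (e j) = if i = j then 1 else 0)
    (hφ : ∀ x, ∑ i, |φ i x| ≤ ‖x‖) :
    (n : ℝ) ^ n / n.factorial ≤ polConst n E := by
  have hn0 : (0 : ℝ) < n := by exact_mod_cast hn
  have hf : (0 : ℝ) < n.factorial := by exact_mod_cast n.factorial_pos
  let L : ContinuousMultilinearMap ℝ (fun _ : Fin n => E) ℝ :=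
    ∑ σ : Equiv.Perm (Fin n), (ContinuousMultilinearMap.mkPiAlgebra ℝ (Fin n) ℝ
      ).compContinuousLinearMap (fun i => φ (σ i))
  have hLx : ∀ x, L x = ∑ σ : Equiv.Perm (Fin n), ∏ i, φ (σ i) (x i) := by
    intro x
    simp [L]
  have hLs : ∀ (σ : Equiv.Perm (Fin n)) (x : Fin n → E), L (x ∘ σ) = L x := by
    intro σ x
    rw [hLx, hLx]
    refine Fintype.sum_equiv (Equiv.mulRight σ⁻¹) _ _ fun τ => ?_
    refine Fintype.prod_equiv σ _ _ fun i => ?_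
    simp
  have hLd : ∀ x, (L fun _ => x) = n.factorial * ∏ i, φ i x := by
    intro x
    rw [hLx]
    have : ∀ σ : Equiv.Perm (Fin n), ∏ i, φ (σ i) x = ∏ i, φ i x := fun σ =>
      Equiv.prod_comp σ (fun i => φ i x)
    simp [this, Fintype.card_perm]
  have hm : 1 ≤ mNorm L := by
    apply le_csSup (bdd_m L)
    refine ⟨e, he, ?_⟩
    rw [hLx, Finset.sum_eq_single (1 : Equiv.Perm (Fin n))]
    · simp [hφe]
    · intro σ _ hσ
      obtain ⟨i, hi⟩ : ∃ i, σ i ≠ i := by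
        by_contra! h
        exact hσ (Equiv.ext h)
      exact Finset.prod_eq_zero (Finset.mem_univ i) (by simp [hφe, hi])
    · simp
  have hq : qNorm L ≤ n.factorial / (n : ℝ) ^ n := by
    apply Real.sSup_le _ (by positivity)
    rintro r ⟨x, hx, rfl⟩
    rw [hLd, abs_mul, Finset.abs_prod, abs_of_pos hf, div_eq_mul_one_div]
    gcongr
    exact amgm hn _ (fun i => abs_nonneg _) ((hφ x).trans hx)
  have hq0 : 0 < qNorm L := by
    have h := le_qNorm L (∑ i, e i) ?_ hn
    · rw [hLd] at h
      have h1 : ∀ i, φ i (∑ j, e j) = 1 := by intro i; simp [hφe]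
      simp only [h1, Finset.prod_const_one, mul_one, abs_of_pos hf] at h
      exact pos_of_mul_pos_right (hf.trans_le h) (by positivity)
    · refine (norm_sum_le _ _).trans ?_
      refine (Finset.sum_le_card_nsmul _ _ 1 fun i _ => he i).trans ?_
      simp
  have hr : (n : ℝ) ^ n / n.factorial ≤ mNorm L / qNorm L := by
    rw [le_div_iff₀ hq0]
    refine le_trans ?_ hm
    calc (n : ℝ) ^ n / n.factorial * qNorm L
        ≤ (n : ℝ) ^ n / n.factorial * (n.factorial / (n : ℝ) ^ n) := by gcongr
      _ = 1 := by field_simp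
  refine hr.trans (le_csSup ⟨(n : ℝ) ^ n / n.factorial, ?_⟩ ⟨L, hLs, rfl⟩)
  rintro r ⟨M, hM, rfl⟩
  exact ratio_le hn M hM

/-- For `n ≤ m ≤ ∞`, the polarization constant of `ℓ₁^m` equals `nⁿ/n!`, and `nⁿ/n!` is the
maximum of `c_s(n,E)` over all normed spaces `E`; thus `ℓ₁ⁿ` and `ℓ₁` are extremal. -/
theorem polConst_l1 (n : ℕ) (hn : 1 ≤ n) :
    (∀ m : ℕ, n ≤ m →
        polConst n (PiLp 1 fun _ : Fin m => ℝ) = (n : ℝ) ^ n / n.factorial) ∧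
      polConst n (lp (fun _ : ℕ => ℝ) 1) = (n : ℝ) ^ n / n.factorial ∧
      ∀ (E : Type*) [NormedAddCommGroup E] [NormedSpace ℝ E],
        polConst n E ≤ (n : ℝ) ^ n / n.factorial := by
  refine ⟨fun m hm => le_antisymm (polConst_le hn) ?_, le_antisymm (polConst_le hn) ?_,
    fun E _ _ => polConst_le hn⟩
  · refine le_polConst hn (fun i => PiLp.proj 1 (fun _ : Fin m => ℝ) (Fin.castLE hm i))
      (fun i => PiLp.single 1 (Fin.castLE hm i) (1 : ℝ)) ?_ ?_ ?_
    · intro i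
      simp
    · intro i j
      simp [PiLp.single_apply]
    · intro x
      rw [PiLp.norm_eq_of_L1]
      have h := Finset.sum_le_sum_of_subset_of_nonneg
        (Finset.subset_univ (Finset.univ.map (Fin.castLEEmb hm)))
        (fun i _ _ => norm_nonneg (x i))
      rw [Finset.sum_map] at h
      simpa using h
  · refine le_polConst hn (fun i => lp.evalCLM ℝ (fun _ : ℕ => ℝ) 1 (i : ℕ))
      (fun i => lp.single 1 (i : ℕ) (1 : ℝ)) ?_ ?_ ?_
    · intro i
      rw [lp.norm_single (by norm_num)]
      simp
    · intro i j
      change (lp.single 1 (j : ℕ) (1 : ℝ) : lp (fun _ : ℕ => ℝ) 1) (i : ℕ) = _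
      simp [lp.single_apply, Pi.single_apply, Fin.ext_iff]
    · intro x
      have h := lp.sum_rpow_le_norm_rpow (by simp) x (Finset.range n)
      simp only [ENNReal.toReal_one, Real.rpow_one] at h
      rw [Finset.sum_range] at h
      exact h

end
end

section
/- Let E and F be normed spaces, T : E → F a bounded linear operator onto F, and A ≥ 0 a constant such that for every x ∈ F and every ε > 0 there exists y ∈ E with Ty = x and ‖y‖ ≤ (A+ε)‖x‖. Then for every n ≥ 1, c_s(n,F) ≤ (A·‖T‖)ⁿ · c_s(n,E). -/
open scoped BigOperators

noncomputable section

section Helpers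

variable {E : Type*} [NormedAddCommGroup E] [NormedSpace ℝ E] {n : ℕ}

lemma aux_limit {a X m : ℝ} (h : ∀ c, a < c → X ≤ c ^ n * m) : X ≤ a ^ n * m := by
  have hc : Continuous (fun c : ℝ => c ^ n * m) := by fun_prop
  have ht : Filter.Tendsto (fun c : ℝ => c ^ n * m) (nhdsWithin a (Set.Ioi a))
      (nhds (a ^ n * m)) := (hc.tendsto a).mono_left nhdsWithin_le_nhds
  exact ge_of_tendsto ht (by
    filter_upwards [self_mem_nhdsWithin] with c hc using h c hc)

lemma m_bdd (L : ContinuousMultilinearMap ℝ (fun _ : Fin n => E) ℝ) :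
    BddAbove {r : ℝ | ∃ x : Fin n → E, (∀ i, ‖x i‖ ≤ 1) ∧ r = |L x|} := by
  refine ⟨‖L‖, ?_⟩
  rintro r ⟨x, hx, rfl⟩
  have h := L.le_opNorm x
  have h2 : ∏ i, ‖x i‖ ≤ 1 := Finset.prod_le_one (fun i _ => norm_nonneg _) (fun i _ => hx i)
  rw [Real.norm_eq_abs] at h
  exact h.trans (mul_le_of_le_one_right (norm_nonneg _) h2)

lemma q_bdd (L : ContinuousMultilinearMap ℝ (fun _ : Fin n => E) ℝ) :
    BddAbove {r : ℝ | ∃ x : E, ‖x‖ ≤ 1 ∧ r = |L fun _ => x|} := by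
  refine (m_bdd L).mono ?_
  rintro r ⟨x, hx, rfl⟩
  exact ⟨fun _ => x, fun _ => hx, rfl⟩

lemma q_nonneg (L : ContinuousMultilinearMap ℝ (fun _ : Fin n => E) ℝ) : 0 ≤ qNorm L := by
  apply Real.sSup_nonneg
  rintro r ⟨x, hx, rfl⟩
  exact abs_nonneg _

lemma m_nonneg (L : ContinuousMultilinearMap ℝ (fun _ : Fin n => E) ℝ) : 0 ≤ mNorm L := by
  apply Real.sSup_nonneg
  rintro r ⟨x, hx, rfl⟩
  exact abs_nonneg _

lemma scale_eq (L : ContinuousMultilinearMap ℝ (fun _ : Fin n => E) ℝ) {c : ℝ} (hc : 0 < c)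
    (x : Fin n → E) : |L x| = c ^ n * |L fun i => c⁻¹ • x i| := by
  rw [L.map_smul_univ (fun _ => c⁻¹) x]
  simp only [Finset.prod_const, Finset.card_univ, Fintype.card_fin, smul_eq_mul, abs_mul]
  rw [abs_of_nonneg (by positivity : (0 : ℝ) ≤ c⁻¹ ^ n), ← mul_assoc, ← mul_pow,
    mul_inv_cancel₀ hc.ne', one_pow, one_mul]

lemma scale_norm {c : ℝ} (hc : 0 < c) {x : E} (hx : ‖x‖ ≤ c) : ‖c⁻¹ • x‖ ≤ 1 := by
  rw [norm_smul, norm_inv, Real.norm_of_nonneg hc.le]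
  rw [inv_mul_le_iff₀ hc]; simpa using hx

lemma m_le (L : ContinuousMultilinearMap ℝ (fun _ : Fin n => E) ℝ) {c : ℝ} (hc : 0 < c)
    (x : Fin n → E) (hx : ∀ i, ‖x i‖ ≤ c) : |L x| ≤ c ^ n * mNorm L := by
  rw [scale_eq L hc x]
  refine mul_le_mul_of_nonneg_left (le_csSup (m_bdd L) ?_) (by positivity)
  exact ⟨_, fun i => scale_norm hc (hx i), rfl⟩

lemma q_le (L : ContinuousMultilinearMap ℝ (fun _ : Fin n => E) ℝ) {c : ℝ} (hc : 0 < c)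
    (x : E) (hx : ‖x‖ ≤ c) : |L fun _ => x| ≤ c ^ n * qNorm L := by
  rw [scale_eq L hc _]
  refine mul_le_mul_of_nonneg_left (le_csSup (q_bdd L) ?_) (by positivity)
  exact ⟨_, scale_norm hc hx, rfl⟩

lemma coef_zero (f : Fin n → Fin n) (hf : ¬ Function.Surjective f) :
    ∑ e : Fin n → ℤˣ, (((∏ i, e i) * ∏ i, e (f i) : ℤˣ) : ℤ) = 0 := by
  classical
  simp only [Function.Surjective, not_forall, not_exists] at hf
  obtain ⟨j, hj⟩ := hf
  have h := Equiv.sum_comp (Equiv.mulLeft (Pi.mulSingle j (-1) : Fin n → ℤˣ))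
    (fun e : Fin n → ℤˣ => (((∏ i, e i) * ∏ i, e (f i) : ℤˣ) : ℤ))
  have h2 : ∀ e : Fin n → ℤˣ,
      ((((∏ i, (Equiv.mulLeft (Pi.mulSingle j (-1) : Fin n → ℤˣ)) e i) *
        ∏ i, (Equiv.mulLeft (Pi.mulSingle j (-1) : Fin n → ℤˣ)) e (f i) : ℤˣ)) : ℤ)
      = - (((∏ i, e i) * ∏ i, e (f i) : ℤˣ) : ℤ) := by
    intro e
    have h3 : ∏ i, (Pi.mulSingle j (-1) : Fin n → ℤˣ) i = -1 := by
      simp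
    have h4 : ∏ i, (Pi.mulSingle j (-1) : Fin n → ℤˣ) (f i) = 1 :=
      Finset.prod_eq_one fun i _ => Pi.mulSingle_eq_of_ne (hj i) _
    simp only [Equiv.coe_mulLeft, Pi.mul_apply, Finset.prod_mul_distrib, h3, h4]
    simp
  rw [Finset.sum_congr rfl (fun e _ => h2 e), Finset.sum_neg_distrib] at h
  omega

lemma coef_perm (f : Fin n → Fin n) (hf : Function.Bijective f) :
    ∑ e : Fin n → ℤˣ, (((∏ i, e i) * ∏ i, e (f i) : ℤˣ) : ℤ) = 2 ^ n := by
  have : ∀ e : Fin n → ℤˣ, ∏ i, e (f i) = ∏ i, e i := fun e => hf.prod_comp e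
  simp [this, Int.units_mul_self, ← Units.val_mul]

lemma polar (L : ContinuousMultilinearMap ℝ (fun _ : Fin n => E) ℝ)
    (hL : ∀ (σ : Equiv.Perm (Fin n)) (x : Fin n → E), L (x ∘ σ) = L x) (x : Fin n → E) :
    ∑ e : Fin n → ℤˣ, (((∏ i, e i : ℤˣ) : ℤ) : ℝ) * L (fun _ => ∑ j, (((e j : ℤ)) : ℝ) • x j)
      = 2 ^ n * (n.factorial : ℝ) * L x := by
  classical
  have h1 : ∀ e : Fin n → ℤˣ,
      (((∏ i, e i : ℤˣ) : ℤ) : ℝ) * L (fun _ => ∑ j, (((e j : ℤ)) : ℝ) • x j)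
      = ∑ f : Fin n → Fin n,
        (((((∏ i, e i) * ∏ i, e (f i) : ℤˣ) : ℤ)) : ℝ) * L (x ∘ f) := by
    intro e
    have := L.toMultilinearMap.map_sum (fun _ j => (((e j : ℤ)) : ℝ) • x j)
    simp only [ContinuousMultilinearMap.coe_coe] at this
    rw [this, Finset.mul_sum]
    refine Finset.sum_congr rfl fun f _ => ?_
    rw [L.map_smul_univ (fun i => (((e (f i) : ℤ)) : ℝ)) (fun i => x (f i))]
    simp only [Units.val_mul, Units.coe_prod, Int.cast_mul, Int.cast_prod, smul_eq_mul, mul_assoc]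
    rfl
  rw [Finset.sum_congr rfl fun e _ => h1 e, Finset.sum_comm]
  have h2 : ∀ f : Fin n → Fin n, ∑ e : Fin n → ℤˣ,
      (((((∏ i, e i) * ∏ i, e (f i) : ℤˣ) : ℤ)) : ℝ) * L (x ∘ f)
      = if Function.Bijective f then 2 ^ n * L x else 0 := by
    intro f
    rw [← Finset.sum_mul, ← Int.cast_sum]
    split_ifs with hf
    · rw [coef_perm f hf]
      have := hL (Equiv.ofBijective f hf) x
      simp only [Equiv.coe_ofBijective] at this
      rw [this]; push_cast; rfl
    · rw [coef_zero f (fun h => hf (Finite.surjective_iff_bijective.mp h))]; simp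
  rw [Finset.sum_congr rfl fun f _ => h2 f, ← Finset.sum_filter, Finset.sum_const]
  have hcard : (Finset.univ.filter fun f : Fin n → Fin n => Function.Bijective f).card
      = n.factorial := by
    rw [← Fintype.card_subtype, ← Fintype.card_congr (Equiv.ofBijective
      (fun σ : Equiv.Perm (Fin n) => (⟨σ, σ.bijective⟩ :
        {f : Fin n → Fin n // Function.Bijective f})) ⟨fun a b h => ?_, fun f => ?_⟩),
      Fintype.card_perm, Fintype.card_fin]
    · simpa using h
    · exact ⟨Equiv.ofBijective f.1 f.2, rfl⟩
  rw [hcard, nsmul_eq_mul]; ring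

lemma m_le_q (hn : 1 ≤ n) (L : ContinuousMultilinearMap ℝ (fun _ : Fin n => E) ℝ)
    (hL : ∀ (σ : Equiv.Perm (Fin n)) (x : Fin n → E), L (x ∘ σ) = L x) :
    mNorm L ≤ (n : ℝ) ^ n * qNorm L := by
  have hn0 : (0 : ℝ) < n := by exact_mod_cast hn
  apply Real.sSup_le
  · rintro r ⟨x, hx, rfl⟩
    have key : |2 ^ n * (n.factorial : ℝ) * L x| ≤ 2 ^ n * ((n : ℝ) ^ n * qNorm L) := by
      rw [← polar L hL x]
      refine (Finset.abs_sum_le_sum_abs _ _).trans ?_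
      refine (Finset.sum_le_card_nsmul _ _ ((n : ℝ) ^ n * qNorm L) fun e _ => ?_).trans ?_
      · rw [abs_mul]
        have hu : ∀ u : ℤˣ, |((u : ℤ) : ℝ)| = 1 := by
          intro u
          rcases Int.units_eq_one_or u with h | h <;> simp [h]
        rw [hu, one_mul]
        apply q_le L hn0
        refine (norm_sum_le _ _).trans ?_
        refine (Finset.sum_le_card_nsmul _ _ 1 fun j _ => ?_).trans (by simp)
        rw [norm_smul, Real.norm_eq_abs, hu, one_mul]
        exact hx j
      · simp
    rw [abs_mul, abs_of_nonneg (by positivity), mul_assoc] at key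
    have key2 := le_of_mul_le_mul_left key (by positivity)
    have hf : (1 : ℝ) ≤ n.factorial := by exact_mod_cast n.factorial_pos
    exact (le_mul_of_one_le_left (abs_nonneg _) hf).trans key2
  · have := q_nonneg L
    positivity

lemma pol_bdd (hn : 1 ≤ n) : BddAbove {r : ℝ | ∃ L : ContinuousMultilinearMap ℝ
    (fun _ : Fin n => E) ℝ,
    (∀ (σ : Equiv.Perm (Fin n)) (x : Fin n → E), L (x ∘ σ) = L x) ∧
    r = mNorm L / qNorm L} := by
  refine ⟨(n : ℝ) ^ n, ?_⟩
  rintro r ⟨L, hL, rfl⟩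
  exact div_le_of_le_mul₀ (q_nonneg L) (by positivity) (m_le_q hn L hL)

lemma pol_nonneg : 0 ≤ polConst n E := by
  apply Real.sSup_nonneg
  rintro r ⟨L, hL, rfl⟩
  exact div_nonneg (m_nonneg L) (q_nonneg L)

end Helpers

/-- If `T : E → F` is a bounded linear operator onto `F` and `A ≥ 0` is such that every `x ∈ F`
admits, for every `ε > 0`, a preimage `y` with `‖y‖ ≤ (A+ε)‖x‖`, then
`c_s(n,F) ≤ (A‖T‖)ⁿ · c_s(n,E)`. -/
theorem polConst_lift_le {E F : Type*} [NormedAddCommGroup E] [NormedSpace ℝ E]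
    [NormedAddCommGroup F] [NormedSpace ℝ F] (n : ℕ) (hn : 1 ≤ n)
    (T : E →L[ℝ] F) (hsurj : Function.Surjective T) (A : ℝ) (hA : 0 ≤ A)
    (hlift : ∀ x : F, ∀ ε : ℝ, 0 < ε → ∃ y : E, T y = x ∧ ‖y‖ ≤ (A + ε) * ‖x‖) :
    polConst n F ≤ (A * ‖T‖) ^ n * polConst n E := by
  have hP : 0 ≤ polConst n E := pol_nonneg
  have hR : 0 ≤ (A * ‖T‖) ^ n * polConst n E := by positivity
  apply Real.sSup_le _ hR
  rintro r ⟨L, hL, rfl⟩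
  let M : ContinuousMultilinearMap ℝ (fun _ : Fin n => E) ℝ :=
    L.compContinuousLinearMap (fun _ => T)
  have hM : ∀ x : Fin n → E, M x = L (fun i => T (x i)) := fun x => rfl
  have hMs : ∀ (σ : Equiv.Perm (Fin n)) (x : Fin n → E), M (x ∘ σ) = M x := fun σ x =>
    hL σ (fun i => T (x i))
  have hlift' : ∀ c, A < c → ∀ x : F, ‖x‖ ≤ 1 → ∃ y : E, T y = x ∧ ‖y‖ ≤ c := by
    intro c hc x hx
    obtain ⟨y, hy, hyn⟩ := hlift x (c - A) (sub_pos.2 hc)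
    refine ⟨y, hy, hyn.trans ?_⟩
    rw [add_sub_cancel]
    exact mul_le_of_le_one_right (hA.trans hc.le) hx
  have h1 : mNorm L ≤ A ^ n * mNorm M := by
    apply Real.sSup_le
    · rintro r ⟨x, hx, rfl⟩
      refine aux_limit fun c hc => ?_
      choose y hy hyn using fun i => hlift' c hc (x i) (hx i)
      have : L x = M y := by rw [hM]; simp only [hy]
      rw [this]
      exact m_le M (hA.trans_lt hc) y hyn
    · have := m_nonneg M
      positivity
  have h2 : qNorm L ≤ A ^ n * qNorm M := by
    apply Real.sSup_le
    · rintro r ⟨x, hx, rfl⟩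
      refine aux_limit fun c hc => ?_
      obtain ⟨y, rfl, hyn⟩ := hlift' c hc x hx
      exact q_le M (hA.trans_lt hc) y hyn
    · have := q_nonneg M
      positivity
  have h3 : qNorm M ≤ ‖T‖ ^ n * qNorm L := by
    apply Real.sSup_le
    · rintro r ⟨x, hx, rfl⟩
      refine aux_limit fun c hc => ?_
      refine q_le L ((norm_nonneg T).trans_lt hc) (T x) ?_
      exact (T.le_opNorm x).trans ((mul_le_of_le_one_right (norm_nonneg _) hx).trans hc.le)
    · have := q_nonneg L
      positivity
  rcases (q_nonneg L).eq_or_lt with h0 | h0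
  · rw [← h0, div_zero]; exact hR
  have hqM : 0 < qNorm M := by
    rcases (q_nonneg M).eq_or_lt with h | h
    · rw [← h, mul_zero] at h2; exact absurd h2 (not_le.2 h0)
    · exact h
  have h4 : mNorm M / qNorm M ≤ polConst n E := le_csSup (pol_bdd hn) ⟨M, hMs, rfl⟩
  have h5 : mNorm M ≤ polConst n E * qNorm M := (div_le_iff₀ hqM).1 h4
  rw [div_le_iff₀ h0]
  calc mNorm L ≤ A ^ n * (polConst n E * qNorm M) := h1.trans (by gcongr)
    _ ≤ A ^ n * (polConst n E * (‖T‖ ^ n * qNorm L)) := by gcongr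
    _ = (A * ‖T‖) ^ n * polConst n E * qNorm L := by rw [mul_pow]; ring

end
end

section
/- Let E be an ordered normed space and n ≥ 1. For every 𝐱 ∈ E^⊗n, the positive projective norm equals the projective tensor norm taken with respect to the norm ‖·‖₊: ‖𝐱‖_{π+} = inf{ Σ_k |a_k|·‖x_{1k}‖₊⋯‖x_{nk}‖₊ : 𝐱 = Σ_k a_k x_{1k}⊗⋯⊗x_{nk} }, where the infimum is over all finite representations with arbitrary (not necessarily positive) x_{ik} ∈ E. -/
open scoped BigOperators TensorProduct
open PiTensorProduct

noncomputable section

/-- The projective tensor norm `‖·‖_π` on the `n`-th algebraic tensor power `E^⊗n`. -/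
def projNorm {E : Type*} [NormedAddCommGroup E] [NormedSpace ℝ E] (n : ℕ)
    (t : ⨂[ℝ] (_ : Fin n), E) : ℝ :=
  sInf {s : ℝ | ∃ (N : ℕ) (a : Fin N → ℝ) (x : Fin N → Fin n → E),
    t = ∑ k, a k • (⨂ₜ[ℝ] i, x k i) ∧ s = ∑ k, |a k| * ∏ i, ‖x k i‖}

/-- The positive projective tensor norm `‖·‖_{π+}` on `E^⊗n`: only decompositions into
elementary tensors of elements of the positive cone `P` are allowed. -/
def projNormPos {E : Type*} [NormedAddCommGroup E] [NormedSpace ℝ E] (P : Set E) (n : ℕ)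
    (t : ⨂[ℝ] (_ : Fin n), E) : ℝ :=
  sInf {s : ℝ | ∃ (N : ℕ) (a : Fin N → ℝ) (x : Fin N → Fin n → E),
    (∀ k i, x k i ∈ P) ∧ t = ∑ k, a k • (⨂ₜ[ℝ] i, x k i) ∧
    s = ∑ k, |a k| * ∏ i, ‖x k i‖}

/-- The symmetric projective tensor norm `‖·‖_{πs}` (decompositions into tensor powers). -/
def symProjNorm {E : Type*} [NormedAddCommGroup E] [NormedSpace ℝ E] (n : ℕ)
    (t : ⨂[ℝ] (_ : Fin n), E) : ℝ :=
  sInf {s : ℝ | ∃ (N : ℕ) (a : Fin N → ℝ) (x : Fin N → E),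
    t = ∑ k, a k • (⨂ₜ[ℝ] (_ : Fin n), x k) ∧ s = ∑ k, |a k| * ‖x k‖ ^ n}

/-- The positive symmetric projective tensor norm `‖·‖_{πs+}` (decompositions into tensor
powers of elements of the positive cone `P`). -/
def symProjNormPos {E : Type*} [NormedAddCommGroup E] [NormedSpace ℝ E] (P : Set E) (n : ℕ)
    (t : ⨂[ℝ] (_ : Fin n), E) : ℝ :=
  sInf {s : ℝ | ∃ (N : ℕ) (a : Fin N → ℝ) (x : Fin N → E),
    (∀ k, x k ∈ P) ∧ t = ∑ k, a k • (⨂ₜ[ℝ] (_ : Fin n), x k) ∧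
    s = ∑ k, |a k| * ‖x k‖ ^ n}

/-- `‖x‖₊ = inf{‖y‖+‖z‖ : x = y − z, y,z ∈ P}`. -/
def normPlus {E : Type*} [NormedAddCommGroup E] (P : Set E) (x : E) : ℝ :=
  sInf {r : ℝ | ∃ y ∈ P, ∃ z ∈ P, x = y - z ∧ r = ‖y‖ + ‖z‖}

/-- `c₊(E) = sup{‖x‖₊ : ‖x‖ ≤ 1}`. -/
def cPlus {E : Type*} [NormedAddCommGroup E] (P : Set E) : ℝ :=
  sSup {r : ℝ | ∃ x : E, ‖x‖ ≤ 1 ∧ r = normPlus P x}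

/-- `P` is a closed generating cone in `E`, i.e. `E` with `P` is an ordered normed space
with `E = P − P`. -/
def IsGenCone {E : Type*} [NormedAddCommGroup E] [NormedSpace ℝ E] (P : Set E) : Prop :=
  IsClosed P ∧ (∀ x ∈ P, ∀ y ∈ P, x + y ∈ P) ∧
    (∀ (c : ℝ), 0 ≤ c → ∀ x ∈ P, c • x ∈ P) ∧
    ∀ x : E, ∃ y ∈ P, ∃ z ∈ P, x = y - z

/-- `c₊(E)` is finite. -/
def CPlusFinite {E : Type*} [NormedAddCommGroup E] (P : Set E) : Prop :=
  BddAbove {r : ℝ | ∃ x : E, ‖x‖ ≤ 1 ∧ r = normPlus P x}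

theorem projNormPos_rep_fintype {E : Type*} [NormedAddCommGroup E] [NormedSpace ℝ E] (P : Set E)
    (n : ℕ) (t : ⨂[ℝ] (_ : Fin n), E) {ι : Type} [Fintype ι] (a : ι → ℝ) (x : ι → Fin n → E)
    (hx : ∀ k i, x k i ∈ P) (ht : t = ∑ k, a k • (⨂ₜ[ℝ] i, x k i)) :
    (∑ k, |a k| * ∏ i, ‖x k i‖) ∈ {s : ℝ | ∃ (N : ℕ) (a : Fin N → ℝ) (x : Fin N → Fin n → E),
    (∀ k i, x k i ∈ P) ∧ t = ∑ k, a k • (⨂ₜ[ℝ] i, x k i) ∧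
    s = ∑ k, |a k| * ∏ i, ‖x k i‖} := by
  let e := (Fintype.equivFin ι).symm
  refine ⟨Fintype.card ι, fun k => a (e k), fun k => x (e k), fun k i => hx _ _, ?_, ?_⟩
  · rw [ht]
    exact (Equiv.sum_comp e (fun k => a k • (⨂ₜ[ℝ] i, x k i))).symm
  · exact (Equiv.sum_comp e (fun k => |a k| * ∏ i, ‖x k i‖)).symm

theorem tprod_sub_expand {E : Type*} [NormedAddCommGroup E] [NormedSpace ℝ E]
    (n : ℕ) (y z : Fin n → E) :
    (⨂ₜ[ℝ] i, (y i - z i)) = ∑ σ : Fin n → Bool,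
      (∏ i, (if σ i then (1:ℝ) else -1)) • (⨂ₜ[ℝ] i, (if σ i then y i else z i)) := by
  have h : (fun i => y i - z i) = fun i => ∑ b : Bool,
      (if b then (1:ℝ) else -1) • (if b then y i else z i) := by
    funext i
    simp [sub_eq_add_neg]
  rw [h, MultilinearMap.map_sum]
  refine Finset.sum_congr rfl fun σ _ => ?_
  exact MultilinearMap.map_smul_univ (PiTensorProduct.tprod ℝ) _ _

theorem prod_add_expand {E : Type*} [NormedAddCommGroup E]
    (n : ℕ) (y z : Fin n → E) :
    ∏ i, (‖y i‖ + ‖z i‖) = ∑ σ : Fin n → Bool,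
      ∏ i, ‖if σ i then y i else z i‖ := by
  have h : ∀ i, ‖y i‖ + ‖z i‖ = ∑ b : Bool, ‖if b then y i else z i‖ := by
    intro i
    simp
  simp_rw [h]
  rw [Finset.prod_univ_sum, Fintype.piFinset_univ]

theorem rep_sub {E : Type*} [NormedAddCommGroup E] [NormedSpace ℝ E] (P : Set E)
    (n : ℕ) (t : ⨂[ℝ] (_ : Fin n), E) (N : ℕ) (a : Fin N → ℝ) (y z : Fin N → Fin n → E)
    (hy : ∀ k i, y k i ∈ P) (hz : ∀ k i, z k i ∈ P)
    (ht : t = ∑ k, a k • (⨂ₜ[ℝ] i, (y k i - z k i))) :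
    (∑ k, |a k| * ∏ i, (‖y k i‖ + ‖z k i‖)) ∈
    {s : ℝ | ∃ (N : ℕ) (a : Fin N → ℝ) (x : Fin N → Fin n → E),
    (∀ k i, x k i ∈ P) ∧ t = ∑ k, a k • (⨂ₜ[ℝ] i, x k i) ∧
    s = ∑ k, |a k| * ∏ i, ‖x k i‖} := by
  have := projNormPos_rep_fintype P n t (ι := Fin N × (Fin n → Bool))
    (fun p => a p.1 * ∏ i, (if p.2 i then (1:ℝ) else -1))
    (fun p i => if p.2 i then y p.1 i else z p.1 i) ?_ ?_
  · convert this using 1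
    rw [Fintype.sum_prod_type]
    refine Finset.sum_congr rfl fun k _ => ?_
    rw [prod_add_expand, Finset.mul_sum]
    refine Finset.sum_congr rfl fun σ _ => ?_
    have h1 : |∏ i, (if σ i then (1:ℝ) else -1)| = 1 := by
      rw [Finset.abs_prod]
      refine Finset.prod_eq_one fun i _ => ?_
      split_ifs <;> simp
    simp only [abs_mul, h1, mul_one]
  · intro p i
    split_ifs
    · exact hy _ _
    · exact hz _ _
  · rw [ht, Fintype.sum_prod_type]
    refine Finset.sum_congr rfl fun k _ => ?_
    rw [tprod_sub_expand, Finset.smul_sum]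
    refine Finset.sum_congr rfl fun σ _ => ?_
    simp only [mul_smul]

theorem normPlus_bdd {E : Type*} [NormedAddCommGroup E] (P : Set E) (x : E) :
    BddBelow {r : ℝ | ∃ y ∈ P, ∃ z ∈ P, x = y - z ∧ r = ‖y‖ + ‖z‖} := by
  refine ⟨0, ?_⟩
  rintro r ⟨y, -, z, -, -, rfl⟩
  positivity

theorem normPlus_nonneg {E : Type*} [NormedAddCommGroup E] (P : Set E) (x : E) :
    0 ≤ normPlus P x := by
  refine Real.sInf_nonneg ?_
  rintro r ⟨y, -, z, -, -, rfl⟩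
  positivity

/-- The positive projective norm `‖·‖_{π+}` on `E^⊗n` equals the projective tensor norm taken
with respect to the norm `‖·‖₊`, i.e. the infimum of `Σ|aₖ|·‖x₁ₖ‖₊⋯‖xₙₖ‖₊` over all finite
representations with arbitrary `xᵢₖ ∈ E`. -/
theorem projNormPos_eq_projNorm_normPlus {E : Type*} [NormedAddCommGroup E] [NormedSpace ℝ E]
    (P : Set E) (hP : IsGenCone P) (hfin : CPlusFinite P) (n : ℕ) (hn : 1 ≤ n)
    (t : ⨂[ℝ] (_ : Fin n), E) :
    projNormPos P n t =
      sInf {s : ℝ | ∃ (N : ℕ) (a : Fin N → ℝ) (x : Fin N → Fin n → E),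
        t = ∑ k, a k • (⨂ₜ[ℝ] i, x k i) ∧
        s = ∑ k, |a k| * ∏ i, normPlus P (x k i)} := by
  obtain ⟨-, -, hsm, hgen⟩ := hP
  have h0 : (0 : E) ∈ P := by
    obtain ⟨y, hy, -⟩ := hgen 0
    simpa using hsm 0 le_rfl y hy
  have hle : ∀ x ∈ P, normPlus P x ≤ ‖x‖ := fun x hx =>
    csInf_le (normPlus_bdd P x) ⟨x, hx, 0, h0, by simp, by simp⟩
  have happ : ∀ ε : ℝ, 0 < ε → ∀ x : E, ∃ y ∈ P, ∃ z ∈ P, x = y - z ∧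
      ‖y‖ + ‖z‖ ≤ normPlus P x + ε := by
    intro ε hε x
    obtain ⟨y, hy, z, hz, h⟩ := hgen x
    obtain ⟨r, ⟨y, hy, z, hz, h, rfl⟩, hr⟩ := Real.lt_sInf_add_pos
      (s := {r : ℝ | ∃ y ∈ P, ∃ z ∈ P, x = y - z ∧ r = ‖y‖ + ‖z‖})
      ⟨_, y, hy, z, hz, h, rfl⟩ hε
    exact ⟨y, hy, z, hz, h, hr.le⟩
  unfold projNormPos
  set A := {s : ℝ | ∃ (N : ℕ) (a : Fin N → ℝ) (x : Fin N → Fin n → E),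
    (∀ k i, x k i ∈ P) ∧ t = ∑ k, a k • (⨂ₜ[ℝ] i, x k i) ∧
    s = ∑ k, |a k| * ∏ i, ‖x k i‖} with hA
  set B := {s : ℝ | ∃ (N : ℕ) (a : Fin N → ℝ) (x : Fin N → Fin n → E),
        t = ∑ k, a k • (⨂ₜ[ℝ] i, x k i) ∧
        s = ∑ k, |a k| * ∏ i, normPlus P (x k i)} with hB
  have hAbdd : BddBelow A := by
    refine ⟨0, ?_⟩
    rintro s ⟨N, a, x, -, -, rfl⟩
    positivity
  have hBbdd : BddBelow B := by
    refine ⟨0, ?_⟩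
    rintro s ⟨N, a, x, -, rfl⟩
    exact Finset.sum_nonneg fun k _ => mul_nonneg (abs_nonneg _)
      (Finset.prod_nonneg fun i _ => normPlus_nonneg _ _)
  have hstep : ∀ (N : ℕ) (a : Fin N → ℝ) (x : Fin N → Fin n → E),
      t = ∑ k, a k • (⨂ₜ[ℝ] i, x k i) → ∀ ε : ℝ, 0 < ε →
      ∃ s ∈ A, s ≤ ∑ k, |a k| * ∏ i, (normPlus P (x k i) + ε) := by
    intro N a x ht ε hε
    choose y hy z hz hxyz hn using fun k i => happ ε hε (x k i)
    refine ⟨_, rep_sub P n t N a y z hy hz ?_, ?_⟩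
    · simp_rw [← hxyz]
      exact ht
    · refine Finset.sum_le_sum fun k _ => mul_le_mul_of_nonneg_left ?_ (abs_nonneg _)
      exact Finset.prod_le_prod (fun i _ => by positivity) (fun i _ => hn k i)
  have hAB : ∀ s ∈ A, ∃ r ∈ B, r ≤ s := by
    rintro s ⟨N, a, x, hx, ht, rfl⟩
    refine ⟨_, ⟨N, a, x, ht, rfl⟩, ?_⟩
    refine Finset.sum_le_sum fun k _ => mul_le_mul_of_nonneg_left ?_ (abs_nonneg _)
    exact Finset.prod_le_prod (fun i _ => normPlus_nonneg _ _) (fun i _ => hle _ (hx k i))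
  rcases B.eq_empty_or_nonempty with hBe | hBn
  · have hAe : A = ∅ := by
      refine Set.eq_empty_of_forall_notMem fun s hs => ?_
      obtain ⟨r, hr, -⟩ := hAB s hs
      rw [hBe] at hr
      exact hr
    rw [hAe, hBe]
  have hAn : A.Nonempty := by
    obtain ⟨s, N, a, x, ht, -⟩ := hBn
    obtain ⟨r, hr, -⟩ := hstep N a x ht 1 one_pos
    exact ⟨r, hr⟩
  apply le_antisymm
  · refine le_csInf hBn ?_
    rintro s ⟨N, a, x, ht, rfl⟩
    have hlim : Filter.Tendsto (fun ε : ℝ => ∑ k, |a k| * ∏ i, (normPlus P (x k i) + ε))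
        (nhdsWithin 0 (Set.Ioi 0)) (nhds (∑ k, |a k| * ∏ i, normPlus P (x k i))) := by
      have hc : Continuous (fun ε : ℝ => ∑ k, |a k| * ∏ i, (normPlus P (x k i) + ε)) := by
        fun_prop
      have := (hc.tendsto 0).mono_left (nhdsWithin_le_nhds (s := Set.Ioi 0))
      simpa using this
    refine ge_of_tendsto hlim ?_
    filter_upwards [self_mem_nhdsWithin] with ε hε
    obtain ⟨s, hs, hsl⟩ := hstep N a x ht ε hε
    exact (csInf_le hAbdd hs).trans hsl
  · refine le_csInf hAn fun s hs => ?_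
    obtain ⟨r, hr, hrs⟩ := hAB s hs
    exact (csInf_le hBbdd hr).trans hrs

end
end

section
/- Let E be an ordered normed space and n ≥ 1. Then for every 𝐱 ∈ E^⊗n, ‖𝐱‖_π ≤ ‖𝐱‖_{π+} ≤ c₊(E)ⁿ · ‖𝐱‖_π. -/
open scoped BigOperators TensorProduct
open PiTensorProduct

noncomputable section

lemma aux_split {E : Type*} [NormedAddCommGroup E] [NormedSpace ℝ E]
    (P : Set E) (hP : IsGenCone P) (hfin : CPlusFinite P) (ε : ℝ) (hε : 0 < ε) (x : E) :
    ∃ y ∈ P, ∃ z ∈ P, x = y - z ∧ ‖y‖ + ‖z‖ ≤ (cPlus P + ε) * ‖x‖ := by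
  obtain ⟨-, -, hsm, hgen⟩ := hP
  by_cases hx : x = 0
  · obtain ⟨y, hy, -⟩ := hgen 0
    have h0 : (0 : E) ∈ P := by simpa using hsm 0 le_rfl y hy
    exact ⟨0, h0, 0, h0, by simp [hx], by simp [hx]⟩
  have hx' : 0 < ‖x‖ := norm_pos_iff.mpr hx
  have h1 : normPlus P (‖x‖⁻¹ • x) ≤ cPlus P := by
    apply le_csSup hfin
    refine ⟨_, ?_, rfl⟩
    rw [norm_smul, norm_inv, norm_norm, inv_mul_cancel₀ hx'.ne']
  have h2 : normPlus P (‖x‖⁻¹ • x) < cPlus P + ε := by linarith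
  have hne : {r : ℝ | ∃ y ∈ P, ∃ z ∈ P, ‖x‖⁻¹ • x = y - z ∧ r = ‖y‖ + ‖z‖}.Nonempty := by
    obtain ⟨y, hy, z, hz, h⟩ := hgen (‖x‖⁻¹ • x)
    exact ⟨_, y, hy, z, hz, h, rfl⟩
  obtain ⟨r, ⟨y, hy, z, hz, h, rfl⟩, hr⟩ := exists_lt_of_csInf_lt hne h2
  refine ⟨‖x‖ • y, hsm _ hx'.le y hy, ‖x‖ • z, hsm _ hx'.le z hz, ?_, ?_⟩
  · rw [← smul_sub, ← h, smul_smul, mul_inv_cancel₀ hx'.ne', one_smul]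
  · rw [norm_smul, norm_smul, norm_norm, ← mul_add, mul_comm]
    gcongr

lemma aux_pos {E : Type*} [NormedAddCommGroup E] [NormedSpace ℝ E]
    (P : Set E) (C : ℝ)
    (hC : ∀ x : E, ∃ y ∈ P, ∃ z ∈ P, x = y - z ∧ ‖y‖ + ‖z‖ ≤ C * ‖x‖) (n : ℕ)
    (t : ⨂[ℝ] (_ : Fin n), E) (N : ℕ) (a : Fin N → ℝ) (x : Fin N → Fin n → E)
    (ht : t = ∑ k, a k • (⨂ₜ[ℝ] i, x k i)) :
    ∃ s, (∃ (N : ℕ) (a : Fin N → ℝ) (x : Fin N → Fin n → E),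
      (∀ k i, x k i ∈ P) ∧ t = ∑ k, a k • (⨂ₜ[ℝ] i, x k i) ∧
      s = ∑ k, |a k| * ∏ i, ‖x k i‖) ∧ s ≤ C ^ n * ∑ k, |a k| * ∏ i, ‖x k i‖ := by
  choose y hy z hz hyz hle using hC
  let p : E → Bool → E := fun x b => if b then y x else z x
  let σ : Bool → ℝ := fun b => if b then 1 else -1
  let e := (Fintype.equivFin (Fin N × (Fin n → Bool))).symm
  let A : Fin N × (Fin n → Bool) → ℝ := fun q => a q.1 * ∏ i, σ (q.2 i)
  let X : Fin N × (Fin n → Bool) → Fin n → E := fun q i => p (x q.1 i) (q.2 i)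
  refine ⟨_, ⟨_, fun k => A (e k), fun k => X (e k), ?_, ?_, rfl⟩, ?_⟩
  · intro k i
    simp only [X, p]
    split_ifs
    · exact hy _
    · exact hz _
  · rw [e.sum_comp (fun q => A q • (⨂ₜ[ℝ] i, X q i)), Fintype.sum_prod_type, ht]
    refine Finset.sum_congr rfl fun k _ => ?_
    have h1 : x k = fun i => ∑ b, σ b • p (x k i) b := by
      funext i
      simp only [Fintype.sum_bool, σ, p]
      simp only [if_true, one_smul, neg_smul, Bool.false_eq_true, if_false]
      rw [← sub_eq_add_neg]
      exact hyz _
    conv_lhs => rw [h1]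
    rw [MultilinearMap.map_sum, Finset.smul_sum]
    refine Finset.sum_congr rfl fun r _ => ?_
    rw [MultilinearMap.map_smul_univ, smul_smul]
  · rw [e.sum_comp (fun q => |A q| * ∏ i, ‖X q i‖), Fintype.sum_prod_type, Finset.mul_sum]
    refine Finset.sum_le_sum fun k _ => ?_
    have h2 : ∀ r : Fin n → Bool, |A (k, r)| = |a k| := by
      intro r
      have : ∀ b, |σ b| = 1 := by intro b; cases b <;> simp [σ]
      simp [A, abs_mul, Finset.abs_prod, this]
    simp only [h2]
    rw [← Finset.mul_sum]
    have h3 : ∑ r : Fin n → Bool, ∏ i, ‖X (k, r) i‖ = ∏ i, ∑ b, ‖p (x k i) b‖ := by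
      rw [Finset.prod_univ_sum, Fintype.piFinset_univ]
    rw [h3, mul_left_comm]
    refine mul_le_mul_of_nonneg_left ?_ (abs_nonneg _)
    calc ∏ i, ∑ b, ‖p (x k i) b‖ ≤ ∏ i, (C * ‖x k i‖) := by
          refine Finset.prod_le_prod (fun i _ => by positivity) fun i _ => ?_
          simpa [p] using hle (x k i)
      _ = _ := by simp [Finset.prod_mul_distrib]

/-- For an ordered normed space `E` and every `𝐱 ∈ E^⊗n`:
`‖𝐱‖_π ≤ ‖𝐱‖_{π+} ≤ c₊(E)ⁿ·‖𝐱‖_π`. -/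
theorem projNorm_le_projNormPos_le {E : Type*} [NormedAddCommGroup E] [NormedSpace ℝ E]
    (P : Set E) (hP : IsGenCone P) (hfin : CPlusFinite P) (n : ℕ) (hn : 1 ≤ n)
    (t : ⨂[ℝ] (_ : Fin n), E) :
    projNorm n t ≤ projNormPos P n t ∧
      projNormPos P n t ≤ cPlus P ^ n * projNorm n t := by
  have hne : {s : ℝ | ∃ (N : ℕ) (a : Fin N → ℝ) (x : Fin N → Fin n → E),
      t = ∑ k, a k • (⨂ₜ[ℝ] i, x k i) ∧ s = ∑ k, |a k| * ∏ i, ‖x k i‖}.Nonempty := by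
    have h : t ∈ Submodule.span ℝ (Set.range (PiTensorProduct.tprod ℝ (s := fun _ : Fin n => E))) := by
      rw [PiTensorProduct.span_tprod_eq_top]; trivial
    obtain ⟨N, a, g, h⟩ := Submodule.mem_span_set'.mp h
    choose x hx using fun k => (g k).2
    exact ⟨_, N, a, x, by simp only [hx, h], rfl⟩
  have hnn : ∀ s : ℝ, (∃ (N : ℕ) (a : Fin N → ℝ) (x : Fin N → Fin n → E),
      (∀ k i, x k i ∈ P) ∧ t = ∑ k, a k • (⨂ₜ[ℝ] i, x k i) ∧
      s = ∑ k, |a k| * ∏ i, ‖x k i‖) → 0 ≤ s := by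
    rintro s ⟨N, a, x, -, -, rfl⟩
    positivity
  have hc : 0 ≤ cPlus P := by
    apply Real.sSup_nonneg
    rintro r ⟨x, -, rfl⟩
    apply Real.sInf_nonneg
    rintro r ⟨y, -, z, -, -, rfl⟩
    positivity
  constructor
  · apply csInf_le_csInf
    · refine ⟨0, ?_⟩
      rintro s ⟨N, a, x, -, rfl⟩
      positivity
    · obtain ⟨s, N, a, x, h, -⟩ := hne
      obtain ⟨s, hs, -⟩ := aux_pos P _ (aux_split P hP hfin 1 one_pos) n t N a x h
      exact ⟨s, hs⟩
    · rintro s ⟨N, a, x, -, h⟩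
      exact ⟨N, a, x, h⟩
  · have key : ∀ ε : ℝ, 0 < ε → projNormPos P n t ≤ (cPlus P + ε) ^ n * projNorm n t := by
      intro ε hε
      have hpos : 0 < (cPlus P + ε) ^ n := by positivity
      rw [← div_le_iff₀' hpos]
      apply le_csInf hne
      rintro s ⟨N, a, x, h, rfl⟩
      rw [div_le_iff₀' hpos]
      obtain ⟨s, hs, hle⟩ := aux_pos P _ (aux_split P hP hfin ε hε) n t N a x h
      exact (csInf_le ⟨0, fun s hs => hnn s hs⟩ hs).trans hle
    have hcont : Filter.Tendsto (fun ε : ℝ => (cPlus P + ε) ^ n * projNorm n t)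
        (nhdsWithin 0 (Set.Ioi 0)) (nhds ((cPlus P + 0) ^ n * projNorm n t)) :=
      (Continuous.tendsto (by fun_prop) 0).mono_left nhdsWithin_le_nhds
    rw [add_zero] at hcont
    refine ge_of_tendsto hcont ?_
    filter_upwards [self_mem_nhdsWithin] with ε hε using key ε hε

end
end

section
/- Let n ≥ 1 and work in E = ℓ₁², ℝ² with the ℓ₁ norm and coordinatewise order. Then the positive symmetric projective norm of the n-th tensor power of (1,−1) is ‖(e₁−e₂)^⊗n‖_{πs+} = 2^{2n−1}. -/
open scoped BigOperators TensorProduct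
open PiTensorProduct

noncomputable section

theorem aux_split_s11 {R : Type*} [AddCommMonoid R] (f : ℕ → R) (n : ℕ) :
    ∑ m ∈ Finset.range (2 * n + 1), f m =
      ∑ k ∈ Finset.range (n + 1), f (2 * k) + ∑ k ∈ Finset.range n, f (2 * k + 1) := by
  induction n with
  | zero => simp
  | succ n ih =>
    rw [show 2 * (n + 1) + 1 = (2 * n + 1) + 1 + 1 by ring, Finset.sum_range_succ,
      Finset.sum_range_succ, ih, Finset.sum_range_succ (fun k => f (2 * k)) (n + 1),
      Finset.sum_range_succ (fun k => f (2 * k + 1)) n]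
    rw [show 2 * (n + 1) = 2 * n + 1 + 1 by ring]
    abel

theorem aux_binom {R : Type*} [CommRing R] (A B : R) (n : ℕ) :
    (A + B) ^ (2 * n) + (A - B) ^ (2 * n) =
      2 * ∑ k ∈ Finset.range (n + 1), ((2 * n).choose (2 * k) : R) *
        ((A ^ 2) ^ (n - k) * (B ^ 2) ^ k) := by
  have h1 := add_pow B A (2 * n)
  have h2 := add_pow (-B) A (2 * n)
  rw [add_comm A B, show A - B = -B + A by ring, h1, h2, ← Finset.sum_add_distrib, aux_split_s11,
    Finset.mul_sum]
  rw [Finset.sum_eq_zero (s := Finset.range n), add_zero]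
  · refine Finset.sum_congr rfl fun k hk => ?_
    rw [← pow_mul A, ← pow_mul B, Nat.mul_sub, pow_mul (-B), neg_sq, ← pow_mul]
    ring
  · intro k _
    rw [Odd.neg_pow ⟨k, rfl⟩]
    ring

theorem aux_bound (n : ℕ) (x y : ℝ) (hx : 0 ≤ x) (hy : 0 ≤ y) :
    |∑ k ∈ Finset.range (n + 1), ((2 * n).choose (2 * k) : ℝ) * (-1) ^ k *
        (x ^ (n - k) * y ^ k)| ≤ (x + y) ^ n := by
  obtain ⟨u, rfl⟩ : ∃ u, x = u ^ 2 := ⟨√x, (Real.sq_sqrt hx).symm⟩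
  obtain ⟨v, rfl⟩ : ∃ v, y = v ^ 2 := ⟨√y, (Real.sq_sqrt hy).symm⟩
  have h := aux_binom (u : ℂ) (v * Complex.I) n
  have e : ((∑ k ∈ Finset.range (n + 1), ((2 * n).choose (2 * k) : ℝ) * (-1) ^ k *
        ((u ^ 2) ^ (n - k) * (v ^ 2) ^ k) : ℝ) : ℂ) =
      ((u + v * Complex.I) ^ (2 * n) + (u - v * Complex.I) ^ (2 * n)) / 2 := by
    rw [h, mul_div_cancel_left₀ _ two_ne_zero]
    push_cast
    refine Finset.sum_congr rfl fun k _ => ?_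
    rw [mul_pow (v : ℂ) Complex.I 2, Complex.I_sq, mul_neg_one, neg_pow ((v : ℂ) ^ 2)]
    ring
  have n1 : ‖(u + v * Complex.I : ℂ)‖ ^ 2 = u ^ 2 + v ^ 2 := by
    rw [Complex.sq_norm, Complex.normSq_add_mul_I]
  have n2 : ‖(u - v * Complex.I : ℂ)‖ ^ 2 = u ^ 2 + v ^ 2 := by
    have : (u - v * Complex.I : ℂ) = (u : ℂ) + ((-v : ℝ) : ℂ) * Complex.I := by push_cast; ring
    rw [this, Complex.sq_norm, Complex.normSq_add_mul_I]; ring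
  rw [← Real.norm_eq_abs, ← Complex.norm_real, e, norm_div]
  have := norm_add_le ((u + v * Complex.I : ℂ) ^ (2 * n)) ((u - v * Complex.I) ^ (2 * n))
  rw [norm_pow, norm_pow, pow_mul ‖(u + v * Complex.I : ℂ)‖,
    pow_mul ‖(u - v * Complex.I : ℂ)‖, n1, n2] at this
  rw [Complex.norm_ofNat]
  linarith

theorem aux_value (n : ℕ) (hn : 1 ≤ n) :
    ∑ k ∈ Finset.range (n + 1), ((2 * n).choose (2 * k) : ℝ) * (-1) ^ k *
        ((1 : ℝ) ^ (n - k) * (-1) ^ k) = 2 ^ (2 * n - 1) := by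
  have h := aux_binom (1 : ℝ) 1 n
  rw [sub_self, zero_pow (by omega), add_zero, one_add_one_eq_two] at h
  have h2 : (2 : ℝ) ^ (2 * n) = 2 * 2 ^ (2 * n - 1) := by
    rw [← pow_succ']; congr 1; omega
  rw [h2] at h
  rw [mul_left_cancel₀ two_ne_zero h]
  refine Finset.sum_congr rfl fun k _ => ?_
  have : ((-1 : ℝ)) ^ k * (-1) ^ k = 1 := by rw [← mul_pow]; simp
  simp only [one_pow, one_mul, mul_one]
  rw [mul_assoc, this, mul_one]

/-- The functional with diagonal `x^(n-k) y^k`. -/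
def auxMono (n k : ℕ) : MultilinearMap ℝ (fun _ : Fin n => PiLp 1 fun _ : Fin 2 => ℝ) ℝ :=
  (MultilinearMap.mkPiAlgebra ℝ (Fin n) ℝ).compLinearMap
    (fun i => (LinearMap.proj (if i.val < k then (1 : Fin 2) else 0)) ∘ₗ
      (WithLp.linearEquiv 1 ℝ (Fin 2 → ℝ)).toLinearMap)

theorem auxMono_diag (n k : ℕ) (hk : k ≤ n) (x : PiLp 1 fun _ : Fin 2 => ℝ) :
    auxMono n k (fun _ => x) = x 0 ^ (n - k) * x 1 ^ k := by
  have : auxMono n k (fun _ => x) = ∏ i : Fin n, if i.val < k then x 1 else x 0 := by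
    simp only [auxMono, MultilinearMap.compLinearMap_apply, MultilinearMap.mkPiAlgebra_apply]
    refine Finset.prod_congr rfl fun i _ => ?_
    split_ifs <;> simp
  rw [this, Fin.prod_univ_eq_prod_range (fun i => if i < k then x 1 else x 0) n]
  obtain ⟨m, rfl⟩ := Nat.exists_eq_add_of_le hk
  rw [Finset.prod_range_add]
  rw [Finset.prod_congr rfl (g := fun _ => x 1)
    (fun i hi => by simp [Finset.mem_range.1 hi])]
  simp [mul_comm]

/-- The Chebyshev functional. -/
def auxF (n : ℕ) : (⨂[ℝ] (_ : Fin n), PiLp 1 fun _ : Fin 2 => ℝ) →ₗ[ℝ] ℝ :=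
  ∑ k ∈ Finset.range (n + 1), (((2 * n).choose (2 * k) : ℝ) * (-1) ^ k) •
    PiTensorProduct.lift (auxMono n k)

theorem auxF_diag (n : ℕ) (x : PiLp 1 fun _ : Fin 2 => ℝ) :
    auxF n (⨂ₜ[ℝ] (_ : Fin n), x) =
      ∑ k ∈ Finset.range (n + 1), ((2 * n).choose (2 * k) : ℝ) * (-1) ^ k *
        (x 0 ^ (n - k) * x 1 ^ k) := by
  simp only [auxF, LinearMap.sum_apply, LinearMap.smul_apply, PiTensorProduct.lift.tprod,
    smul_eq_mul]
  refine Finset.sum_congr rfl fun k hk => ?_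
  rw [auxMono_diag n k (Nat.lt_succ_iff.1 (Finset.mem_range.1 hk))]

theorem aux_geom {ω : ℂ} {N d : ℕ} (h : IsPrimitiveRoot ω N) (hd : ¬ N ∣ d) :
    ∑ j ∈ Finset.range N, ω ^ (j * d) = 0 := by
  have h1 : ω ^ d ≠ 1 := fun h' => hd (h.dvd_of_pow_eq_one d h')
  simp_rw [mul_comm _ d, pow_mul]
  rw [geom_sum_eq h1, ← pow_mul, mul_comm, pow_mul, h.pow_eq_one, one_pow, sub_self, zero_div]

theorem aux_cos (n k : ℕ) (hn : 1 ≤ n) (hk : k ≤ n) :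
    ∑ j ∈ Finset.range (2 * n), (-1 : ℝ) ^ j * Real.cos (j * (Real.pi / n)) ^ k =
      if k = n then 4 * (n : ℝ) / 2 ^ n else 0 := by
  have hn0 : (n : ℂ) ≠ 0 := by exact_mod_cast (by omega : n ≠ 0)
  have hw := Complex.isPrimitiveRoot_exp (2 * n) (by omega)
  set ω := Complex.exp (2 * Real.pi * Complex.I / (2 * n : ℕ)) with hω
  have hω' : ω = Complex.exp (Real.pi / n * Complex.I) := by
    rw [hω]; congr 1; push_cast; field_simp
  have hωn : ω ^ n = -1 := by
    rw [hω', ← Complex.exp_nat_mul, ← Complex.exp_pi_mul_I]; congr 1; field_simp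
  have hterm : ∀ j : ℕ, (-1 : ℂ) ^ j * Complex.cos (j * (Real.pi / n)) ^ k =
      ∑ m ∈ Finset.range (k + 1), (k.choose m : ℂ) / 2 ^ k * ω ^ (j * (n - k + 2 * m)) := by
    intro j
    have hc : Complex.cos (j * (Real.pi / n)) * (2 * ω ^ j) = (ω ^ j) ^ 2 + 1 := by
      have e1 : ω ^ j = Complex.exp (j * (Real.pi / n) * Complex.I) := by
        rw [hω', ← Complex.exp_nat_mul]; congr 1; ring
      rw [e1, Complex.cos, neg_mul, Complex.exp_neg]
      have := Complex.exp_ne_zero (j * (Real.pi / n) * Complex.I)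
      field_simp
    have e2 : (-1 : ℂ) ^ j = (ω ^ j) ^ (n - k) * (ω ^ j) ^ k := by
      rw [← pow_add, Nat.sub_add_cancel hk, ← hωn, ← pow_mul, ← pow_mul, mul_comm]
    have e3 : (-1 : ℂ) ^ j * Complex.cos (j * (Real.pi / n)) ^ k =
        (ω ^ j) ^ (n - k) * ((ω ^ j) ^ 2 + 1) ^ k / 2 ^ k := by
      rw [← hc, e2, mul_pow, mul_pow]; field_simp
    rw [e3, add_pow, Finset.mul_sum, Finset.sum_div]
    refine Finset.sum_congr rfl fun m _ => ?_
    rw [pow_mul ω j, pow_add, pow_mul _ 2 m]; simp only [one_pow]; ring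
  have key : ((∑ j ∈ Finset.range (2 * n), (-1 : ℝ) ^ j * Real.cos (j * (Real.pi / n)) ^ k : ℝ) : ℂ)
      = ((if k = n then 4 * (n : ℝ) / 2 ^ n else 0 : ℝ) : ℂ) := by
    push_cast
    simp_rw [hterm]
    rw [Finset.sum_comm]
    simp_rw [← Finset.mul_sum]
    split_ifs with hkn
    · subst hkn
      obtain ⟨p, rfl⟩ : ∃ p, k = p + 1 := ⟨k - 1, by omega⟩
      rw [Finset.sum_range_succ, Finset.sum_range_succ', Finset.sum_eq_zero]
      · have : ∀ j : ℕ, ω ^ (j * (2 * (p + 1))) = 1 := fun j => by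
          rw [mul_comm, pow_mul, hw.pow_eq_one, one_pow]
        simp [this]
        ring
      · intro m hm
        have := Finset.mem_range.1 hm
        rw [aux_geom hw, mul_zero]
        intro hd
        have := Nat.le_of_dvd (by omega) hd
        omega
    · simp only [Complex.ofReal_zero]
      refine Finset.sum_eq_zero fun m hm => ?_
      have := Finset.mem_range.1 hm
      rw [aux_geom hw, mul_zero]
      intro hd
      have := Nat.le_of_dvd (by omega) hd
      omega
  exact Complex.ofReal_injective key

/-- Chebyshev points on the positive part of the unit sphere. -/
def auxPt (n j : ℕ) : PiLp 1 fun _ : Fin 2 => ℝ :=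
  (WithLp.equiv 1 (Fin 2 → ℝ)).symm
    ![(1 + Real.cos (j * (Real.pi / n))) / 2, (1 - Real.cos (j * (Real.pi / n))) / 2]

theorem auxPt_eq (n j : ℕ) : auxPt n j =
    (Real.cos (j * (Real.pi / n)) / 2) • ((WithLp.equiv 1 (Fin 2 → ℝ)).symm ![1, -1]) +
    (1 / 2 : ℝ) • ((WithLp.equiv 1 (Fin 2 → ℝ)).symm ![1, 1]) := by
  ext i
  fin_cases i <;> simp [auxPt] <;> ring

theorem auxPt_nonneg (n j : ℕ) (i : Fin 2) : 0 ≤ auxPt n j i := by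
  have h1 := Real.neg_one_le_cos (j * (Real.pi / n))
  have h2 := Real.cos_le_one (j * (Real.pi / n))
  fin_cases i <;> simp [auxPt] <;> linarith

theorem aux_norm (x : PiLp 1 fun _ : Fin 2 => ℝ) (h : ∀ i, 0 ≤ x i) : ‖x‖ = x 0 + x 1 := by
  rw [PiLp.norm_eq_of_L1, Fin.sum_univ_two, Real.norm_of_nonneg (h 0), Real.norm_of_nonneg (h 1)]

theorem auxPt_norm (n j : ℕ) : ‖auxPt n j‖ = 1 := by
  rw [aux_norm _ (auxPt_nonneg n j)]
  simp [auxPt]; ring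

theorem aux_expand {E : Type*} [AddCommGroup E] [Module ℝ E] (n : ℕ) (c d : ℝ) (A B : E) :
    (⨂ₜ[ℝ] (_ : Fin n), (c • A + d • B)) =
      ∑ s : Finset (Fin n), (c ^ s.card * d ^ (n - s.card)) •
        PiTensorProduct.tprod ℝ (s.piecewise (fun _ => A) (fun _ => B)) := by
  have h := (PiTensorProduct.tprod ℝ (s := fun _ : Fin n => E)).map_add_univ
    (fun _ => c • A) (fun _ => d • B)
  refine h.trans (Finset.sum_congr rfl fun s _ => ?_)
  have h2 : (s.piecewise (fun _ => c • A) (fun _ => d • B) : Fin n → E) =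
      fun i => (s.piecewise (fun _ => c) (fun _ => d) : Fin n → ℝ) i •
        (s.piecewise (fun _ => A) (fun _ => B) : Fin n → E) i := by
    funext i
    by_cases hi : i ∈ s <;> simp [hi]
  rw [h2, MultilinearMap.map_smul_univ]
  congr 1
  rw [Finset.prod_piecewise]
  simp [Finset.card_sdiff]

theorem aux_decomp (n : ℕ) (hn : 1 ≤ n) :
    (⨂ₜ[ℝ] (_ : Fin n), ((WithLp.equiv 1 (Fin 2 → ℝ)).symm ![1, -1]) :
        ⨂[ℝ] (_ : Fin n), PiLp 1 fun _ : Fin 2 => ℝ) =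
      ∑ j : Fin (2 * n), ((2 ^ (2 * n - 1) / (2 * n) : ℝ) * (-1) ^ j.val) •
        (⨂ₜ[ℝ] (_ : Fin n), auxPt n j) := by
  rw [Fin.sum_univ_eq_sum_range (fun j => ((2 ^ (2 * n - 1) / (2 * n) : ℝ) * (-1) ^ j) •
        (⨂ₜ[ℝ] (_ : Fin n), auxPt n j))]
  simp_rw [auxPt_eq, aux_expand, Finset.smul_sum, smul_smul]
  rw [Finset.sum_comm]
  simp_rw [← Finset.sum_smul]
  have hc : ∀ s : Finset (Fin n), ∑ j ∈ Finset.range (2 * n),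
      (2 ^ (2 * n - 1) / (2 * n) : ℝ) * (-1) ^ j *
        ((Real.cos (j * (Real.pi / n)) / 2) ^ s.card * (1 / 2) ^ (n - s.card)) =
      if s = Finset.univ then 1 else 0 := by
    intro s
    have hs : s.card ≤ n := by simpa using s.card_le_univ
    have h := aux_cos n s.card hn hs
    have e : ∀ j : ℕ, (2 ^ (2 * n - 1) / (2 * n) : ℝ) * (-1) ^ j *
        ((Real.cos (j * (Real.pi / n)) / 2) ^ s.card * (1 / 2) ^ (n - s.card)) =
        (2 ^ (2 * n - 1) / (2 * n) / 2 ^ n : ℝ) *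
          ((-1) ^ j * Real.cos (j * (Real.pi / n)) ^ s.card) := by
      intro j
      have : (2 : ℝ) ^ n = 2 ^ s.card * 2 ^ (n - s.card) := by
        rw [← pow_add, Nat.add_sub_cancel' hs]
      rw [this, div_pow, div_pow, one_pow]
      generalize (2 : ℝ) ^ (n - s.card) = p
      generalize (2 : ℝ) ^ s.card = q
      generalize (2 : ℝ) ^ (2 * n - 1) / (2 * n) = r
      generalize Real.cos (j * (Real.pi / n)) ^ s.card = w
      rw [div_mul_div_comm, mul_one]
      ring
    simp_rw [e]
    rw [← Finset.mul_sum, h]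
    have hiff : s.card = n ↔ s = Finset.univ := by
      rw [← Finset.card_eq_iff_eq_univ, Fintype.card_fin]
    simp only [hiff]
    split_ifs
    · have h2 : (2 : ℝ) ^ n * 2 ^ n = 2 * 2 ^ (2 * n - 1) := by
        rw [← pow_succ', ← pow_add]; congr 1; omega
      have hn0 : (n : ℝ) ≠ 0 := by exact_mod_cast (by omega : n ≠ 0)
      rw [div_div, div_mul_div_comm, div_eq_one_iff_eq (by positivity)]
      linear_combination (-2 * (n : ℝ)) * h2
    · simp
  simp_rw [hc]
  rw [Finset.sum_eq_single Finset.univ]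
  · simp
  · intro s _ hs; simp [hs]
  · simp

/-- In `ℓ₁² = (ℝ², ‖·‖₁)` with the coordinatewise order,
`‖(e₁ − e₂)^⊗n‖_{πs+} = 2^{2n−1}`. -/
theorem symProjNormPos_one_neg_one (n : ℕ) (hn : 1 ≤ n) :
    symProjNormPos {x : PiLp 1 fun _ : Fin 2 => ℝ | ∀ i, 0 ≤ x i} n
        (⨂ₜ[ℝ] (_ : Fin n), ((WithLp.equiv 1 (Fin 2 → ℝ)).symm ![1, -1])) =
      2 ^ (2 * n - 1) := by
  have hn0 : (n : ℝ) ≠ 0 := by exact_mod_cast (by omega : n ≠ 0)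
  refine IsLeast.csInf_eq ⟨?_, ?_⟩
  · refine ⟨2 * n, fun j => (2 ^ (2 * n - 1) / (2 * n) : ℝ) * (-1) ^ j.val,
      fun j => auxPt n j, fun k => auxPt_nonneg n k, aux_decomp n hn, ?_⟩
    simp only [auxPt_norm, one_pow, mul_one, abs_mul, abs_pow, abs_neg, abs_one]
    rw [abs_of_nonneg (by positivity)]
    simp
    field_simp
  · rintro s ⟨N, a, x, hx, ht, rfl⟩
    have h := congrArg (auxF n) ht
    rw [auxF_diag, map_sum] at h
    have hv := aux_value n hn
    have h0 : (2 : ℝ) ^ (2 * n - 1) = ∑ k, auxF n (a k • (⨂ₜ[ℝ] (_ : Fin n), x k)) := by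
      rw [← h, ← hv]; simp
    rw [h0]
    refine Finset.sum_le_sum fun k _ => ?_
    rw [map_smul, smul_eq_mul, auxF_diag]
    refine (le_abs_self _).trans ?_
    rw [abs_mul, aux_norm _ (hx k)]
    exact mul_le_mul_of_nonneg_left (aux_bound n _ _ (hx k 0) (hx k 1)) (abs_nonneg _)

end
end
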